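/- (Proposition 2(ii) of the paper, general case.) Consider two labels with the same current customer n₀, with ν¹(q) ≤ ν²(q) for all q ∈ {0,…,Q} and Γ¹ ≤ Γ². Extend both labels backwardly along the same finite (possibly empty) sequence of customers (i_1,…,i_h), where extending a label with current customer m to customer i replaces ν by (T_{i,m} ν)(q) = min( d(i,m) + Σ_{k=0}^∞ [(d(m,0)+d(0,m))·Ψ(k,q) + ν(Q·Ψ(k,q)+q−k)]·p_m(k) , d(i,0) + d(0,m) + Σ_{k=0}^∞ [(d(m,0)+d(0,m))·Ψ(k,Q) + ν(Q·Ψ(k,Q)+Q−k)]·p_m(k) ), adds γ(i,m) to Γ, and sets the current customer to i. Let (n,ν¹',Γ¹') and (n,ν²',Γ²') be the resulting labels, and define the reduced cost φ(n,ν,Γ) = d(0,n) + Σ_{k=0}^∞ [(d(n,0)+d(0,n))·Ψ(k,Q) + ν(Q·Ψ(k,Q)+Q−k)]·p_n(k) + Γ + γ(0,n). Then φ(n,ν¹',Γ¹') ≤ φ(n,ν²',Γ²'): the route generated from the dominating label has reduced cost not greater than the route generated from the dominated label under any common extension. -/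

import Mathlib

/-- `Ψ(k,q) = max(⌈(k−q)/Q⌉, 0)`: number of replenishment trips of capacity `Q`
needed to fulfill a demand of `k` with remaining quantity `q`. -/
noncomputable def psi (Q k q : ℕ) : ℤ :=
  max ⌈((k : ℚ) - (q : ℚ)) / (Q : ℚ)⌉ 0

/-- The single-step optimal-restocking update operator `T_{i,m}`: extending a
label at current customer `m` backwardly to customer `i`.  The expected
remaining-cost function `ν : {0,…,Q} → ℝ` is modeled as `ν : ℕ → ℝ`; the
post-service remaining quantity `Q·Ψ(k,q)+q−k` (an integer in `{0,…,Q}`) is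
passed via `Int.toNat`. -/
noncomputable def stepT (Q : ℕ) (d p : ℕ → ℕ → ℝ) (i m : ℕ)
    (ν : ℕ → ℝ) (q : ℕ) : ℝ :=
  min
    (d i m + ∑' k : ℕ,
      ((d m 0 + d 0 m) * (psi Q k q : ℝ)
        + ν ((Q : ℤ) * psi Q k q + (q : ℤ) - (k : ℤ)).toNat) * p m k)
    (d i 0 + d 0 m + ∑' k : ℕ,
      ((d m 0 + d 0 m) * (psi Q k Q : ℝ)
        + ν ((Q : ℤ) * psi Q k Q + (Q : ℤ) - (k : ℤ)).toNat) * p m k)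

/-- Backward extension of a label `(current customer, ν, Γ)` along a finite
sequence of customers: extending a label with current customer `m` to customer
`i` replaces `ν` by `T_{i,m} ν`, adds `γ(i,m)` to `Γ`, and sets the current
customer to `i`. -/
noncomputable def extendLabel (Q : ℕ) (d p γ : ℕ → ℕ → ℝ) :
    ℕ × (ℕ → ℝ) × ℝ → List ℕ → ℕ × (ℕ → ℝ) × ℝ
  | L, [] => L
  | (m, ν, Γ), i :: rest =>
      extendLabel Q d p γ (i, stepT Q d p i m ν, Γ + γ i m) rest

/-- Reduced cost of (the route obtained by closing) a label with current
customer `n`, expected remaining-cost function `ν` and accumulated dual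
contribution `Γ`. -/
noncomputable def phiLabel (Q : ℕ) (d p γ : ℕ → ℕ → ℝ)
    (n : ℕ) (ν : ℕ → ℝ) (Γ : ℝ) : ℝ :=
  d 0 n + (∑' k : ℕ,
      ((d n 0 + d 0 n) * (psi Q k Q : ℝ)
        + ν ((Q : ℤ) * psi Q k Q + (Q : ℤ) - (k : ℤ)).toNat) * p n k)
    + Γ + γ 0 n

theorem psi_nonneg (Q k q : ℕ) : 0 ≤ psi Q k q := le_max_right _ _

theorem psi_le {Q : ℕ} (hQ : 1 ≤ Q) (k q : ℕ) : psi Q k q ≤ k := by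
  refine max_le (Int.ceil_le.2 ?_) (Int.natCast_nonneg k)
  have hQ' : (1 : ℚ) ≤ Q := by exact_mod_cast hQ
  have hk : (0 : ℚ) ≤ k := k.cast_nonneg
  have hq : (0 : ℚ) ≤ q := q.cast_nonneg
  rw [div_le_iff₀ (by linarith)]
  push_cast
  nlinarith

/-- The remaining quantity after serving a customer does not exceed the capacity. -/
theorem toNat_remaining_le {Q : ℕ} (hQ : 1 ≤ Q) (k : ℕ) {q : ℕ} (hq : q ≤ Q) :
    ((Q : ℤ) * psi Q k q + (q : ℤ) - (k : ℤ)).toNat ≤ Q := by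
  have hQ' : (0 : ℚ) < Q := by exact_mod_cast hQ
  suffices h : (Q : ℤ) * psi Q k q + q - k ≤ Q by omega
  rcases max_choice ⌈((k : ℚ) - (q : ℚ)) / (Q : ℚ)⌉ 0 with h | h
  · rw [psi, h]
    have hc := Int.ceil_lt_add_one (((k : ℚ) - (q : ℚ)) / (Q : ℚ))
    have hm := mul_lt_mul_of_pos_left hc hQ'
    rw [mul_add, mul_div_cancel₀ _ hQ'.ne'] at hm
    have : (Q : ℤ) * ⌈((k : ℚ) - (q : ℚ)) / (Q : ℚ)⌉ < k - q + Q := by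
      exact_mod_cast (by linarith : (Q : ℚ) * ⌈((k : ℚ) - (q : ℚ)) / (Q : ℚ)⌉ < k - q + Q)
    linarith
  · rw [psi, h]
    omega

/-- The expected service cost at a customer is an absolutely convergent series. -/
theorem summable_serviceCost {Q : ℕ} (hQ : 1 ≤ Q) {q : ℕ} (hq : q ≤ Q) {p : ℕ → ℝ}
    (hp : ∀ k, 0 ≤ p k) (hs : Summable p) (hm : Summable fun k : ℕ => (k : ℝ) * p k)
    (c : ℝ) (ν : ℕ → ℝ) :
    Summable fun k : ℕ =>
      (c * (psi Q k q : ℝ) + ν ((Q : ℤ) * psi Q k q + (q : ℤ) - (k : ℤ)).toNat) * p k := by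
  refine Summable.of_norm_bounded
    ((hm.mul_left |c|).add (hs.mul_left (∑ r ∈ Finset.range (Q + 1), |ν r|))) fun k => ?_
  have hψ : |(psi Q k q : ℝ)| ≤ k := by
    rw [abs_of_nonneg (by exact_mod_cast psi_nonneg Q k q)]
    exact_mod_cast psi_le hQ k q
  have hν : |ν ((Q : ℤ) * psi Q k q + (q : ℤ) - (k : ℤ)).toNat|
      ≤ ∑ r ∈ Finset.range (Q + 1), |ν r| :=
    Finset.single_le_sum (f := fun r => |ν r|) (fun r _ => abs_nonneg (ν r))
      (Finset.mem_range.2 (Nat.lt_succ_of_le (toNat_remaining_le hQ k hq)))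
  rw [Real.norm_eq_abs, abs_mul, abs_of_nonneg (hp k), ← mul_assoc, ← add_mul]
  refine mul_le_mul_of_nonneg_right ((abs_add_le _ _).trans (add_le_add ?_ hν)) (hp k)
  rw [abs_mul]
  exact mul_le_mul_of_nonneg_left hψ (abs_nonneg c)

/-- The expected service cost is monotone in the remaining cost on `{0,…,Q}`. -/
theorem tsum_serviceCost_le {Q : ℕ} (hQ : 1 ≤ Q) {q : ℕ} (hq : q ≤ Q) {p : ℕ → ℝ}
    (hp : ∀ k, 0 ≤ p k) (hs : Summable p) (hm : Summable fun k : ℕ => (k : ℝ) * p k)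
    (c : ℝ) {ν₁ ν₂ : ℕ → ℝ} (hν : ∀ r ≤ Q, ν₁ r ≤ ν₂ r) :
    ∑' k : ℕ,
        (c * (psi Q k q : ℝ) + ν₁ ((Q : ℤ) * psi Q k q + (q : ℤ) - (k : ℤ)).toNat) * p k ≤
      ∑' k : ℕ,
        (c * (psi Q k q : ℝ) + ν₂ ((Q : ℤ) * psi Q k q + (q : ℤ) - (k : ℤ)).toNat) * p k :=
  Summable.tsum_le_tsum
    (fun k => mul_le_mul_of_nonneg_right
      (add_le_add_right (hν _ (toNat_remaining_le hQ k hq)) _) (hp k))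
    (summable_serviceCost hQ hq hp hs hm c ν₁) (summable_serviceCost hQ hq hp hs hm c ν₂)

theorem stepT_le_stepT {Q : ℕ} (hQ : 1 ≤ Q) {q : ℕ} (hq : q ≤ Q) (d : ℕ → ℕ → ℝ)
    {p : ℕ → ℕ → ℝ} (i : ℕ) {m : ℕ} (hp : ∀ k, 0 ≤ p m k) (hs : Summable (p m))
    (hm : Summable fun k : ℕ => (k : ℝ) * p m k)
    {ν₁ ν₂ : ℕ → ℝ} (hν : ∀ r ≤ Q, ν₁ r ≤ ν₂ r) :
    stepT Q d p i m ν₁ q ≤ stepT Q d p i m ν₂ q :=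
  min_le_min
    (add_le_add_right (tsum_serviceCost_le hQ hq hp hs hm _ hν) _)
    (add_le_add_right (tsum_serviceCost_le hQ le_rfl hp hs hm _ hν) _)

/-- Proposition 2(ii) of the paper, general case: if a label
dominates another label with the same current customer (`ν¹ ≤ ν²` on
`{0,…,Q}` and `Γ¹ ≤ Γ²`), then under any common backward extension, the route
generated from the dominating label has reduced cost not greater than the
route generated from the dominated label. -/
theorem stmt6 (Q N : ℕ) (hQ : 1 ≤ Q)
    (d : ℕ → ℕ → ℝ) (hd : ∀ i j, i ≤ N → j ≤ N → 0 ≤ d i j)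
    (p : ℕ → ℕ → ℝ)
    (hp : ∀ m, 1 ≤ m → m ≤ N →
      (∀ k, 0 ≤ p m k) ∧ HasSum (p m) 1 ∧ Summable fun k : ℕ => (k : ℝ) * p m k)
    (γ : ℕ → ℕ → ℝ)
    (n₀ : ℕ) (hn₀ : 1 ≤ n₀ ∧ n₀ ≤ N)
    (ν₁ ν₂ : ℕ → ℝ) (hν : ∀ q : ℕ, q ≤ Q → ν₁ q ≤ ν₂ q)
    (Γ₁ Γ₂ : ℝ) (hΓ : Γ₁ ≤ Γ₂)
    (e : List ℕ) (he : ∀ i ∈ e, 1 ≤ i ∧ i ≤ N) :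
    phiLabel Q d p γ
        (extendLabel Q d p γ (n₀, ν₁, Γ₁) e).1
        (extendLabel Q d p γ (n₀, ν₁, Γ₁) e).2.1
        (extendLabel Q d p γ (n₀, ν₁, Γ₁) e).2.2 ≤
      phiLabel Q d p γ
        (extendLabel Q d p γ (n₀, ν₂, Γ₂) e).1
        (extendLabel Q d p γ (n₀, ν₂, Γ₂) e).2.1
        (extendLabel Q d p γ (n₀, ν₂, Γ₂) e).2.2 := by
  induction e generalizing n₀ ν₁ ν₂ Γ₁ Γ₂ with
  | nil =>
    obtain ⟨hp0, hs, hm⟩ := hp n₀ hn₀.1 hn₀.2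
    have := tsum_serviceCost_le hQ le_rfl hp0 hs.summable hm (d n₀ 0 + d 0 n₀) hν
    simp only [extendLabel, phiLabel]
    linarith
  | cons i rest ih =>
    obtain ⟨hp0, hs, hm⟩ := hp n₀ hn₀.1 hn₀.2
    simp only [extendLabel]
    exact ih i (he i List.mem_cons_self) _ _
      (fun q hq => stepT_le_stepT hQ hq d i hp0 hs.summable hm hν) _ _
      (add_le_add_left hΓ _) fun j hj => he j (List.mem_cons_of_mem i hj)
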